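/- Let N ≥ 2 and let z* > 0 be the unique positive solution of z² = N((z+1)ln(z+1) − z). Define a_N = (z* + N)² / ((z* + 1)·N). Then a_N ≤ e·ln N. -/

import Mathlib

theorem log_lt_half_sub_inv {u : ℝ} (hu : 1 < u) : Real.log u < (u - u⁻¹) / 2 := by
  rw [← Real.sinh_log (by linarith)]
  exact Real.self_lt_sinh_iff.2 (Real.log_pos hu)

theorem log_le_log_add_div_sub_one {u m : ℝ} (hu : 0 < u) (hm : 0 < m) :
    Real.log u ≤ Real.log m + u / m - 1 := by
  have h := Real.log_le_sub_one_of_pos (div_pos hu hm)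
  rw [Real.log_div hu.ne' hm.ne'] at h
  linarith

/-- The lower bound `n - 2 ≤ z` on the solution of the defining equation. -/
theorem sub_two_le_of_scaling_eq {n z : ℝ} (hn : 0 < n) (hz : 0 < z)
    (heq : z ^ 2 = n * ((z + 1) * Real.log (z + 1) - z)) : n - 2 ≤ z := by
  have hL := Real.le_log_one_add_of_nonneg hz.le
  rw [add_comm 1 z, div_le_iff₀ (by linarith)] at hL
  have h1 : z ^ 2 ≤ ((z + 1) * Real.log (z + 1) - z) * (z + 2) := by nlinarith
  have h2 : n * z ^ 2 ≤ z ^ 2 * (z + 2) := by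
    calc n * z ^ 2 ≤ n * (((z + 1) * Real.log (z + 1) - z) * (z + 2)) := by gcongr
      _ = z ^ 2 * (z + 2) := by rw [heq]; ring
  nlinarith [pow_pos hz 2]

/-- Replacing the logarithm by its tangent at `m` turns the defining equation into a quadratic
inequality. -/
theorem scaling_quadratic_le {n z m : ℝ} (hn : 0 < n) (hz : 0 < z) (hm : 0 < m)
    (heq : z ^ 2 = n * ((z + 1) * Real.log (z + 1) - z)) :
    z ^ 2 + n * z ≤ n * (z + 1) * (Real.log m + (z + 1) / m - 1) := by
  have h := log_le_log_add_div_sub_one (u := z + 1) (by linarith) hm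
  calc z ^ 2 + n * z = n * (z + 1) * Real.log (z + 1) := by rw [heq]; ring
    _ ≤ _ := by gcongr

theorem no_scaling_solution_two {z : ℝ} (hz : 0 < z) :
    z ^ 2 ≠ 2 * ((z + 1) * Real.log (z + 1) - z) := by
  intro heq
  have h := log_lt_half_sub_inv (u := z + 1) (by linarith)
  have h1 := mul_lt_mul_of_pos_left h (show 0 < z + 1 by linarith)
  have h2 : (z + 1) * ((z + 1 - (z + 1)⁻¹) / 2) = ((z + 1) ^ 2 - 1) / 2 := by field_simp
  nlinarith

theorem scaling_three_le {z : ℝ} (hz : 0 < z)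
    (heq : z ^ 2 = 3 * ((z + 1) * Real.log (z + 1) - z)) :
    (z + 3) ^ 2 / ((z + 1) * 3) ≤ Real.exp 1 * Real.log 3 := by
  have hlow := sub_two_le_of_scaling_eq (by norm_num) hz heq
  have hquad := scaling_quadratic_le (m := 3) (by norm_num) hz (by norm_num) heq
  have hlog4 : Real.log 4 = 2 * Real.log 2 := by
    rw [show (4 : ℝ) = 2 ^ 2 by norm_num, Real.log_pow]; norm_num
  have hlog8 : Real.log 8 = 3 * Real.log 2 := by
    rw [show (8 : ℝ) = 2 ^ 3 by norm_num, Real.log_pow]; norm_num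
  have hlog9 : Real.log 9 = 2 * Real.log 3 := by
    rw [show (9 : ℝ) = 3 ^ 2 by norm_num, Real.log_pow]; norm_num
  have hup := log_le_log_add_div_sub_one (u := 3) (m := 4) (by norm_num) (by norm_num)
  have hlo := log_le_log_add_div_sub_one (u := 8) (m := 9) (by norm_num) (by norm_num)
  have h2a := Real.log_two_gt_d9
  have h2b := Real.log_two_lt_d9
  have he := Real.exp_one_gt_d9
  have hlog3 : 1.09 ≤ Real.log 3 := by linarith
  have hz3 : z ≤ 2.5 := by
    nlinarith [mul_le_mul_of_nonneg_left (show Real.log 3 ≤ 1.14 by linarith)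
      (show 0 ≤ 3 * (z + 1) by linarith)]
  have hrhs : (2.9 : ℝ) ≤ Real.exp 1 * Real.log 3 := by nlinarith
  refine le_trans ?_ hrhs
  rw [div_le_iff₀ (by linarith)]
  nlinarith [mul_nonneg (show 0 ≤ z - 1 by linarith) (show 0 ≤ 2.5 - z by linarith)]

theorem scaling_four_le {z : ℝ} (hz : 0 < z)
    (heq : z ^ 2 = 4 * ((z + 1) * Real.log (z + 1) - z)) :
    (z + 4) ^ 2 / ((z + 1) * 4) ≤ Real.exp 1 * Real.log 4 := by
  have hlow := sub_two_le_of_scaling_eq (by norm_num) hz heq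
  have hquad := scaling_quadratic_le (m := 4) (by norm_num) hz (by norm_num) heq
  have hlog4 : Real.log 4 = 2 * Real.log 2 := by
    rw [show (4 : ℝ) = 2 ^ 2 by norm_num, Real.log_pow]; norm_num
  have h2a := Real.log_two_gt_d9
  have h2b := Real.log_two_lt_d9
  have he := Real.exp_one_gt_d9
  have hz4 : z ≤ 6 := by
    nlinarith [mul_le_mul_of_nonneg_left (show Real.log 4 ≤ 1.387 by linarith)
      (show 0 ≤ 4 * (z + 1) by linarith)]
  have hrhs : (3.7 : ℝ) ≤ Real.exp 1 * Real.log 4 := by nlinarith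
  refine le_trans ?_ hrhs
  rw [div_le_iff₀ (by linarith)]
  nlinarith [mul_nonneg (show 0 ≤ z - 2 by linarith) (show 0 ≤ 6 - z by linarith)]

theorem scaling_le_of_five_le {n z : ℝ} (hn : 5 ≤ n) (hz : 0 < z)
    (heq : z ^ 2 = n * ((z + 1) * Real.log (z + 1) - z)) :
    (z + n) ^ 2 / ((z + 1) * n) ≤ Real.exp 1 * Real.log n := by
  have hn0 : 0 < n := by linarith
  have hu0 : 0 < z + 1 := by linarith
  have hlow := sub_two_le_of_scaling_eq hn0 hz heq
  have hquad := scaling_quadratic_le (m := 2 * n) hn0 hz (by linarith) heq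
  rw [Real.log_mul two_ne_zero hn0.ne'] at hquad
  have hlog5 := log_le_log_add_div_sub_one (u := 4) (m := 5) (by norm_num) (by norm_num)
  have hlog4 : Real.log 4 = 2 * Real.log 2 := by
    rw [show (4 : ℝ) = 2 ^ 2 by norm_num, Real.log_pow]; norm_num
  have hlogn : Real.log 5 ≤ Real.log n := Real.log_le_log (by norm_num) hn
  have h2a := Real.log_two_gt_d9
  have h2b := Real.log_two_lt_d9
  have he := Real.exp_one_gt_d9
  have hx : 1.5 ≤ Real.log n := by linarith
  have hexp : n * (z + 1) * (Real.log 2 + Real.log n + (z + 1) / (2 * n) - 1) =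
      (z + 1) * (n * (Real.log 2 + Real.log n - 1)) + (z + 1) ^ 2 / 2 := by
    field_simp
    ring
  rw [hexp] at hquad
  have hup : z + 1 ≤ 2 * (n * (Real.log 2 + Real.log n - 2) + 3) := by
    refine le_of_mul_le_mul_left ?_ hu0
    nlinarith
  have hrhs : 2.71 * Real.log n ≤ Real.exp 1 * Real.log n := by gcongr; linarith
  refine le_trans ?_ hrhs
  have hnum : (z + n) ^ 2 ≤ (z + 1) * (z + 1 + 3 * (n - 1)) := by nlinarith
  have hlin : z + 1 + 3 * (n - 1) ≤ 2.71 * Real.log n * n := by nlinarith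
  rw [div_le_iff₀ (by positivity)]
  calc (z + n) ^ 2 ≤ (z + 1) * (z + 1 + 3 * (n - 1)) := hnum
    _ ≤ (z + 1) * (2.71 * Real.log n * n) := by gcongr
    _ = _ := by ring

theorem harmonic_mean_scaling_factor_le (N : ℕ) (hN : 2 ≤ N) (z : ℝ)
    (hz : 0 < z)
    (heq : z ^ 2 = N * ((z + 1) * Real.log (z + 1) - z))
    (huniq : ∀ w : ℝ, 0 < w → w ^ 2 = N * ((w + 1) * Real.log (w + 1) - w) → w = z) :
    (z + N) ^ 2 / ((z + 1) * N) ≤ Real.exp 1 * Real.log N := by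
  obtain rfl | rfl | rfl | h5 : N = 2 ∨ N = 3 ∨ N = 4 ∨ 5 ≤ N := by omega
  · exact absurd (by exact_mod_cast heq) (no_scaling_solution_two hz)
  · exact_mod_cast scaling_three_le hz (by exact_mod_cast heq)
  · exact_mod_cast scaling_four_le hz (by exact_mod_cast heq)
  · exact scaling_le_of_five_le (by exact_mod_cast h5) hz heq
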